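/- arXiv:1706.04846 — 2 statements merged into one kernel-verified Lean document; each statement's English description precedes it below -/
import Mathlib

section
/- Let F : X → ℝ ∪ {+∞} be proper and convex, and define V : X × ℝ → ℝ ∪ {+∞} by V(x, ρ) := F(x) + ρ²/2. Let (x, ρ) ∈ dom f × ℝ with F(x) < +∞, and let (x₊, ρ₊) ∈ T_{A,B}(x, ρ). Suppose either (a) f is strictly differentiable at x₊ with ∇f(x₊) ≠ 0 and v := (f(x₊)/‖∇f(x₊)‖²)·∇f(x₊) ∈ ∂F(x₊), or (b) f(x₊) = 0 and v := 0 ∈ ∂F(x₊). Then ⟨(v, ρ₊), (x, ρ) − (x₊, ρ₊)⟩ = 0 in X × ℝ, and consequently V(x, ρ) − V(x₊, ρ₊) ≥ (ρ − ρ₊)²/2. -/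
open Set Metric Filter
open scoped InnerProductSpace

/-- The Euclidean (ℓ²) distance on the product `X × ℝ`. -/
noncomputable def dist2 {X : Type*} [NormedAddCommGroup X] (z w : X × ℝ) : ℝ :=
  Real.sqrt (‖z.1 - w.1‖ ^ 2 + (z.2 - w.2) ^ 2)

/-- The graph `B = {(x, ρ) : x ∈ dom f, f(x) = ρ}` of the extended-real-valued function
encoded by its effective domain `s` and its real values `f` on `s`. -/
def grph {X : Type*} (s : Set X) (f : X → ℝ) : Set (X × ℝ) :=
  {p | p.1 ∈ s ∧ f p.1 = p.2}

/-- The (possibly set-valued) projector onto the graph `B`, for the Euclidean metric on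
`X × ℝ`: the set of points of `B` nearest to `z`. -/
noncomputable def projB {X : Type*} [NormedAddCommGroup X] (s : Set X) (f : X → ℝ)
    (z : X × ℝ) : Set (X × ℝ) :=
  {b | b ∈ grph s f ∧ ∀ b' ∈ grph s f, dist2 z b ≤ dist2 z b'}

/-- The reflector across `A = X × {0}`: `R_A(x, ρ) = (x, -ρ)`. -/
def reflA {X : Type*} (z : X × ℝ) : X × ℝ := (z.1, -z.2)

/-- The Douglas–Rachford operator `T_{A,B}(z) = {(z + w)/2 : w ∈ R_B(R_A z)}`,
where `R_B(v) = {2b - v : b ∈ P_B(v)}`. -/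
noncomputable def drT {X : Type*} [NormedAddCommGroup X] [Module ℝ X] (s : Set X)
    (f : X → ℝ) (z : X × ℝ) : Set (X × ℝ) :=
  {w | ∃ b ∈ projB s f (reflA z), w = (2 : ℝ)⁻¹ • (z + (2 • b - reflA z))}

/-- The convex subdifferential of the extended function encoded by `(sF, F)` at `p`. -/
def subdiff {X : Type*} [NormedAddCommGroup X] [InnerProductSpace ℝ X]
    (sF : Set X) (F : X → ℝ) (p : X) : Set X :=
  {v | p ∈ sF ∧ ∀ y ∈ sF, F p + ⟪v, y - p⟫_ℝ ≤ F y}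

/-- Strict (Fréchet) differentiability of the extended function encoded by `(s, f)` at
`y`, with gradient `g`. -/
def sdiffAt {X : Type*} [NormedAddCommGroup X] [InnerProductSpace ℝ X]
    (s : Set X) (f : X → ℝ) (g : X) (y : X) : Prop :=
  (∃ ε > 0, Metric.ball y ε ⊆ s) ∧ HasStrictFDerivAt f (innerSL ℝ g) y

/-- A step of the operator from `(x, ρ)` lands at `(y, ρ + f y)`, where `(y, f y)` is a nearest
point of the graph to `(x, -ρ)`. -/
theorem drT_step {X : Type*} [NormedAddCommGroup X] [Module ℝ X] {s : Set X} {f : X → ℝ}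
    {x xp : X} {ρ ρp : ℝ} (h : (xp, ρp) ∈ drT s f (x, ρ)) :
    ρp = ρ + f xp ∧ (xp, f xp) ∈ projB s f (x, -ρ) := by
  obtain ⟨⟨y, r⟩, hb, hw⟩ := h
  obtain ⟨h1, h2⟩ := Prod.ext_iff.1 hw
  obtain rfl : f y = r := hb.1.2
  obtain rfl : xp = y := by
    have h1' : xp = (2 : ℝ)⁻¹ • (x + (2 • y - x)) := h1
    rw [h1', add_sub_cancel, two_nsmul, ← two_smul ℝ y, smul_smul]
    norm_num
  have h2' : ρp = (2 : ℝ)⁻¹ * (ρ + (2 • f xp - -ρ)) := h2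
  refine ⟨?_, hb⟩
  rw [h2', two_nsmul]
  ring

/-- First-order optimality for the projection onto the graph of `f` at a point of strict
differentiability. -/
theorem sub_eq_smul_of_mem_projB {X : Type*} [NormedAddCommGroup X] [InnerProductSpace ℝ X]
    {s : Set X} {f : X → ℝ} {x y g : X} {σ : ℝ} (hproj : (y, f y) ∈ projB s f (x, σ))
    (hd : sdiffAt s f g y) : x - y = (f y - σ) • g := by
  obtain ⟨⟨ε, hε, hball⟩, hf⟩ := hd
  have hmin : IsLocalMin (fun u => ‖x - u‖ ^ 2 + (σ - f u) ^ 2) y := by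
    filter_upwards [Metric.ball_mem_nhds y hε] with u hu
    exact (Real.sqrt_le_sqrt_iff (by positivity)).1 (hproj.2 (u, f u) ⟨hball hu, rfl⟩)
  have hder := (((hasFDerivAt_id y).const_sub x).norm_sq).add
    ((hf.hasFDerivAt.const_sub σ).pow 2)
  have hzero := hmin.hasFDerivAt_eq_zero hder
  have horth : ∀ w : X, ⟪x - y - (f y - σ) • g, w⟫_ℝ = 0 := by
    intro w
    have hw := DFunLike.congr_fun hzero w
    simp at hw
    rw [inner_sub_left (x - y), real_inner_smul_left, inner_sub_left x y w]
    linarith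
  exact sub_eq_zero.1 (inner_self_eq_zero.1 (horth _))

/-- Let `F` be proper convex (encoded by domain `sF` with real values `F`), and set
`V(x, ρ) := F(x) + ρ²/2`.  Let `(x, ρ) ∈ dom f × ℝ` with `F(x) < ∞`, and let
`(x₊, ρ₊) ∈ T_{A,B}(x, ρ)`.  Suppose either
(a) `f` is strictly differentiable at `x₊` with `∇f(x₊) ≠ 0` and
`v := (f(x₊)/‖∇f(x₊)‖²) ∇f(x₊) ∈ ∂F(x₊)`, or (b) `f(x₊) = 0` and `v := 0 ∈ ∂F(x₊)`.
Then `⟨(v, ρ₊), (x, ρ) - (x₊, ρ₊)⟩ = 0` in `X × ℝ`, and consequently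
`V(x, ρ) - V(x₊, ρ₊) ≥ (ρ - ρ₊)²/2`. -/
theorem stmt16 {X : Type*} [NormedAddCommGroup X] [InnerProductSpace ℝ X]
    [FiniteDimensional ℝ X]
    (s : Set X) (f : X → ℝ) (hs : s.Nonempty) (hB : IsClosed (grph s f))
    (sF : Set X) (F : X → ℝ) (hsF : sF.Nonempty) (hFconv : ConvexOn ℝ sF F)
    (x : X) (hx : x ∈ s) (hxF : x ∈ sF) (ρ : ℝ)
    (xp : X) (ρp : ℝ) (hstep : (xp, ρp) ∈ drT s f (x, ρ))
    (v : X)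
    (hcase :
      (∃ g : X, sdiffAt s f g xp ∧ g ≠ 0 ∧ v = (f xp / ‖g‖ ^ 2) • g ∧
        v ∈ subdiff sF F xp) ∨
      (f xp = 0 ∧ v = 0 ∧ v ∈ subdiff sF F xp)) :
    ⟪v, x - xp⟫_ℝ + ρp * (ρ - ρp) = 0 ∧
    (ρ - ρp) ^ 2 / 2 ≤ (F x + ρ ^ 2 / 2) - (F xp + ρp ^ 2 / 2) := by
  obtain ⟨hρ, hproj⟩ := drT_step hstep
  have key : ⟪v, x - xp⟫_ℝ + ρp * (ρ - ρp) = 0 := by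
    rcases hcase with ⟨g, hd, hg, rfl, -⟩ | ⟨hf0, rfl, -⟩
    · have hg' : ‖g‖ ≠ 0 := norm_ne_zero_iff.2 hg
      rw [sub_eq_smul_of_mem_projB hproj hd, real_inner_smul_left, real_inner_smul_right,
        real_inner_self_eq_norm_sq, hρ]
      field_simp
      ring
    · rw [inner_zero_left, hρ, hf0]
      ring
  have hsub : v ∈ subdiff sF F xp := by
    rcases hcase with ⟨_, -, -, -, h⟩ | ⟨-, -, h⟩ <;> exact h
  have hF := hsub.2 x hxF
  exact ⟨key, by nlinarith⟩
end

section
/- Let D be a nonempty convex subset of X and let F : X → ℝ ∪ {+∞} be proper, convex, and coercive with D ⊆ dom F, such that: (i) f is strictly differentiable at every point of D ∖ f⁻¹(0); (ii) for every x ∈ D with f(x) ≠ 0 and ∇f(x) ≠ 0, the vector (f(x)/‖∇f(x)‖²)·∇f(x) lies in the convex subdifferential ∂F(x), and for every x ∈ D with f(x) = 0, 0 ∈ ∂F(x). Let (z_n) = ((x_n, ρ_n)) be a DR sequence such that for some n₀ and all n ≥ n₀: x_n ∈ D, and either f(x_{n+1}) = 0 or ∇f(x_{n+1}) ≠ 0.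 Then (z_n) is bounded, asymptotically regular (z_n − z_{n+1} → 0), and every cluster point z̄ of (z_n) satisfies P_A(z̄) ∈ A ∩ B, i.e. the first coordinate x̄ of z̄ satisfies f(x̄) = 0. -/
open Set Metric Filter
open scoped InnerProductSpace

/-- A Douglas–Rachford step moves the first coordinate to a minimizer over `s` of
`y ↦ ‖x - y‖² + (ρ + f y)²` and adds the value of `f` there to the second coordinate. -/
theorem drT_step_s17 {X : Type*} [NormedAddCommGroup X] [Module ℝ X] {s : Set X}
    {f : X → ℝ} {z w : X × ℝ} (h : w ∈ drT s f z) :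
    w.1 ∈ s ∧ w.2 = z.2 + f w.1 ∧
      ∀ y ∈ s, ‖z.1 - w.1‖ ^ 2 + (z.2 + f w.1) ^ 2 ≤ ‖z.1 - y‖ ^ 2 + (z.2 + f y) ^ 2 := by
  obtain ⟨⟨b, t⟩, ⟨⟨hbs, hbf⟩, hmin⟩, rfl⟩ := h
  have hfst : ((2 : ℝ)⁻¹ • (z + (2 • (b, t) - reflA z))).1 = b := by
    have : z.1 + (2 • b - z.1) = (2 : ℝ) • b := by
      rw [two_smul ℕ, two_smul ℝ]; abel
    change (2 : ℝ)⁻¹ • (z.1 + (2 • b - z.1)) = b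
    rw [this, inv_smul_smul₀ two_ne_zero]
  have hsnd : ((2 : ℝ)⁻¹ • (z + (2 • (b, t) - reflA z))).2 = z.2 + t := by
    simp [reflA]; ring
  rw [hfst, hsnd]
  simp only at hbs hbf
  refine ⟨hbs, by rw [hbf], fun y hy => ?_⟩
  have h1 := hmin (y, f y) ⟨hy, rfl⟩
  simp only [dist2, reflA] at h1
  have h2 := (Real.sqrt_le_sqrt_iff (by positivity)).1 h1
  rw [hbf]
  nlinarith [h2]

/-- First-order optimality condition for a projection onto the graph of `f`. -/
theorem sub_eq_smul_of_isMin {X : Type*} [NormedAddCommGroup X] [InnerProductSpace ℝ X]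
    {s : Set X} {f : X → ℝ} {x y g : X} {r : ℝ} (hd : sdiffAt s f g y)
    (hmin : ∀ u ∈ s, ‖x - y‖ ^ 2 + (r + f y) ^ 2 ≤ ‖x - u‖ ^ 2 + (r + f u) ^ 2) :
    x - y = (r + f y) • g := by
  obtain ⟨⟨ε, hε, hball⟩, hstrict⟩ := hd
  have hloc : IsLocalMin (fun u => ‖x - u‖ ^ 2 + (r + f u) ^ 2) y :=
    Filter.mem_of_superset (Metric.ball_mem_nhds y hε) fun u hu => hmin u (hball hu)
  have hder := (((hasFDerivAt_id y).const_sub x).norm_sq).add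
    ((hstrict.hasFDerivAt.const_add r).pow 2)
  have hzero := hloc.hasFDerivAt_eq_zero hder
  refine ext_inner_right ℝ fun v => ?_
  have hv := congrArg (fun L => L v) hzero
  simp at hv
  rw [inner_smul_left, inner_sub_left]
  simp only [conj_trivial]
  linarith

/-- A coercive function with a subgradient at some point is bounded below. -/
theorem exists_lower_bound_of_mem_subdiff {X : Type*} [NormedAddCommGroup X]
    [InnerProductSpace ℝ X] {sF : Set X} {F : X → ℝ} {p v : X}
    (hcoer : ∀ M : ℝ, ∃ R : ℝ, ∀ x ∈ sF, R ≤ ‖x‖ → M ≤ F x) (hv : v ∈ subdiff sF F p) :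
    ∃ m : ℝ, ∀ x ∈ sF, m ≤ F x := by
  obtain ⟨R, hR⟩ := hcoer 0
  refine ⟨min 0 (F p - ‖v‖ * (R + ‖p‖)), fun x hx => ?_⟩
  rcases le_total R ‖x‖ with h | h
  · exact (min_le_left _ _).trans (hR x hx h)
  · refine (min_le_right _ _).trans ?_
    have h1 := hv.2 x hx
    have h2 : -(‖v‖ * ‖x - p‖) ≤ ⟪v, x - p⟫_ℝ := neg_le_of_abs_le (abs_real_inner_le_norm v _)
    have h3 : ‖v‖ * ‖x - p‖ ≤ ‖v‖ * (R + ‖p‖) := by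
      gcongr
      exact (norm_sub_le _ _).trans (by gcongr)
    linarith

/-- If `V (n + 1) + c n ≤ V n` eventually, with `c ≥ 0` and `V` bounded below, then `V` is
eventually bounded above and `c` tends to `0`. -/
theorem tendsto_zero_of_descent {V c : ℕ → ℝ} {N : ℕ} {m : ℝ} (hc : ∀ n, 0 ≤ c n)
    (hV : ∀ n ≥ N, V (n + 1) + c n ≤ V n) (hm : ∀ n ≥ N, m ≤ V n) :
    (∀ n ≥ N, V n ≤ V N) ∧ Tendsto c atTop (nhds 0) := by
  have hanti : Antitone fun k => V (k + N) := antitone_nat_of_succ_le fun k => by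
    have := hV (k + N) (by omega)
    rw [show k + 1 + N = k + N + 1 by omega]
    linarith [hc (k + N)]
  constructor
  · intro n hn
    simpa [Nat.sub_add_cancel hn] using hanti (Nat.zero_le (n - N))
  · have hbdd : BddBelow (range fun k => V (k + N)) :=
      ⟨m, by rintro _ ⟨k, rfl⟩; exact hm _ (by omega)⟩
    have hlim := tendsto_atTop_ciInf hanti hbdd
    have hdiff := hlim.sub ((tendsto_add_atTop_iff_nat 1).2 hlim)
    rw [sub_self] at hdiff
    refine (tendsto_add_atTop_iff_nat N).1
      (squeeze_zero (fun k => hc _) (fun k => ?_) hdiff)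
    have := hV (k + N) (by omega)
    rw [show k + 1 + N = k + N + 1 by omega]
    linarith

/-- Lyapunov-type convergence theorem for the DRA, first part.  Let `D` be nonempty and
convex, and let `F` be proper convex and coercive (encoded by domain `sF` and values
`F`) with `D ⊆ dom F`, such that (i) `f` is strictly differentiable (gradient `g`) at
every point of `D ∖ f⁻¹(0)`, and (ii) for `x ∈ D` with `f(x) ≠ 0` and `∇f(x) ≠ 0` one
has `(f(x)/‖∇f(x)‖²) ∇f(x) ∈ ∂F(x)`, while for `x ∈ D` with `f(x) = 0` one has
`0 ∈ ∂F(x)`.  If `(z_n)` is a DR sequence with `z_0 ∈ dom f × ℝ` such that for all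
`n ≥ n₀`, `x_n ∈ D` and (`f(x_{n+1}) = 0` or `∇f(x_{n+1}) ≠ 0`), then `(z_n)` is
bounded (in the Euclidean norm of `X × ℝ`), asymptotically regular, and each of its
cluster points `z̄` satisfies `P_A(z̄) ∈ A ∩ B`, i.e. `z̄.1 ∈ dom f` and `f(z̄.1) = 0`. -/
theorem stmt17 {X : Type*} [NormedAddCommGroup X] [InnerProductSpace ℝ X]
    [FiniteDimensional ℝ X]
    (s : Set X) (f : X → ℝ) (hs : s.Nonempty) (hB : IsClosed (grph s f))
    (D : Set X) (hDne : D.Nonempty) (hDconv : Convex ℝ D)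
    (sF : Set X) (F : X → ℝ) (hsF : sF.Nonempty) (hFconv : ConvexOn ℝ sF F)
    (hDsF : D ⊆ sF)
    (hFcoer : ∀ M : ℝ, ∃ R : ℝ, ∀ x ∈ sF, R ≤ ‖x‖ → M ≤ F x)
    (g : X → X)
    (hdiff : ∀ x ∈ D, ¬(x ∈ s ∧ f x = 0) → sdiffAt s f (g x) x)
    (hsub1 : ∀ x ∈ D, x ∈ s → f x ≠ 0 → g x ≠ 0 →
      ((f x / ‖g x‖ ^ 2) • g x) ∈ subdiff sF F x)
    (hsub2 : ∀ x ∈ D, x ∈ s → f x = 0 → (0 : X) ∈ subdiff sF F x)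
    (z : ℕ → X × ℝ) (hz0 : (z 0).1 ∈ s) (hz : ∀ n, z (n + 1) ∈ drT s f (z n))
    (n₀ : ℕ) (hzD : ∀ n ≥ n₀, (z n).1 ∈ D)
    (hcrit : ∀ n ≥ n₀, f ((z (n + 1)).1) = 0 ∨ g ((z (n + 1)).1) ≠ 0) :
    (∃ M : ℝ, ∀ n, Real.sqrt (‖(z n).1‖ ^ 2 + ((z n).2) ^ 2) ≤ M) ∧
    Tendsto (fun n => z n - z (n + 1)) atTop (nhds 0) ∧
    ∀ zbar : X × ℝ, MapClusterPt zbar atTop z → zbar.1 ∈ s ∧ f zbar.1 = 0 := by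
  have hstep := fun n => drT_step_s17 (hz n)
  have hmem : ∀ n, (z n).1 ∈ s
    | 0 => hz0
    | n + 1 => (hstep n).1
  have hdescent : ∀ n ≥ n₀, (F (z (n + 1)).1 + (z (n + 1)).2 ^ 2 / 2) + f (z (n + 1)).1 ^ 2 / 2
      ≤ F (z n).1 + (z n).2 ^ 2 / 2 := by
    intro n hn
    obtain ⟨hs', hρ, hmin⟩ := hstep n
    have hD' := hzD (n + 1) (by omega)
    have hF := hDsF (hzD n hn)
    by_cases h0 : f (z (n + 1)).1 = 0
    · have h1 := (hsub2 _ hD' hs' h0).2 _ hF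
      rw [inner_zero_left] at h1
      rw [h0, add_zero] at hρ
      rw [h0, hρ]
      linarith
    · have hg := (hcrit n hn).resolve_left h0
      have h1 := (hsub1 _ hD' hs' h0 hg).2 _ hF
      rw [sub_eq_smul_of_isMin (hdiff _ hD' fun h => h0 h.2) hmin, real_inner_smul_left,
        real_inner_smul_right, real_inner_self_eq_norm_sq] at h1
      have hg' : ‖g (z (n + 1)).1‖ ^ 2 ≠ 0 := by simpa using hg
      have h2 : f (z (n + 1)).1 / ‖g (z (n + 1)).1‖ ^ 2 *
          (((z n).2 + f (z (n + 1)).1) * ‖g (z (n + 1)).1‖ ^ 2) =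
          f (z (n + 1)).1 * ((z n).2 + f (z (n + 1)).1) := by
        field_simp
      rw [h2] at h1
      rw [hρ]
      nlinarith [h1]
  obtain ⟨m, hm⟩ : ∃ m : ℝ, ∀ x ∈ sF, m ≤ F x := by
    have hD' := hzD (n₀ + 1) (by omega)
    by_cases h0 : f (z (n₀ + 1)).1 = 0
    · exact exists_lower_bound_of_mem_subdiff hFcoer (hsub2 _ hD' (hmem _) h0)
    · exact exists_lower_bound_of_mem_subdiff hFcoer
        (hsub1 _ hD' (hmem _) h0 ((hcrit n₀ le_rfl).resolve_left h0))
  obtain ⟨hVle, hsq⟩ := tendsto_zero_of_descent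
    (m := m) (V := fun n => F (z n).1 + (z n).2 ^ 2 / 2) (c := fun n => f (z (n + 1)).1 ^ 2 / 2)
    (fun n => by positivity) hdescent
    (fun n hn => by linarith [hm _ (hDsF (hzD n hn)), sq_nonneg (z n).2])
  have hf : Tendsto (fun n => f (z n).1) atTop (nhds 0) := by
    refine (tendsto_add_atTop_iff_nat 1).1 ?_
    have h1 := (hsq.const_mul 2).sqrt
    simp only [mul_zero, Real.sqrt_zero] at h1
    refine (tendsto_zero_iff_abs_tendsto_zero _).2 (h1.congr fun n => ?_)
    rw [mul_div_cancel₀ _ two_ne_zero, Real.sqrt_sq_eq_abs]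
    rfl
  set V₀ := F (z n₀).1 + (z n₀).2 ^ 2 / 2
  have hρsq : ∀ n ≥ n₀, (z n).2 ^ 2 ≤ 2 * (V₀ - m) := fun n hn => by
    have h1 := hVle n hn
    have h2 := hm _ (hDsF (hzD n hn))
    linarith
  obtain ⟨R, hR⟩ := hFcoer (V₀ + 1)
  have hx : ∀ n ≥ n₀, ‖(z n).1‖ ≤ R := fun n hn => by
    by_contra! h
    have h1 := hVle n hn
    have h2 := hR _ (hDsF (hzD n hn)) h.le
    linarith [sq_nonneg (z n).2]
  have hbdd : BddAbove (range fun n => Real.sqrt (‖(z n).1‖ ^ 2 + ((z n).2) ^ 2)) := by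
    refine Filter.IsBoundedUnder.bddAbove_range
      ⟨Real.sqrt (R ^ 2 + 2 * (V₀ - m)), eventually_map.2 ?_⟩
    filter_upwards [eventually_ge_atTop n₀] with n hn
    have := hx n hn
    have := hρsq n hn
    gcongr
  obtain ⟨M, hM⟩ := hbdd
  replace hM : ∀ n, Real.sqrt (‖(z n).1‖ ^ 2 + ((z n).2) ^ 2) ≤ M := fun n => hM ⟨n, rfl⟩
  have hρM : ∀ n, |(z n).2| ≤ M := fun n => by
    refine le_trans ?_ (hM n)
    rw [← Real.sqrt_sq_eq_abs]
    exact Real.sqrt_le_sqrt (by linarith [sq_nonneg ‖(z n).1‖])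
  have hf' := (tendsto_add_atTop_iff_nat 1).2 hf
  have hsnd : Tendsto (fun n => (z n).2 - (z (n + 1)).2) atTop (nhds 0) := by
    have h1 := hf'.neg
    rw [neg_zero] at h1
    refine h1.congr fun n => ?_
    rw [(hstep n).2.1]
    ring
  have hfst : Tendsto (fun n => (z n).1 - (z (n + 1)).1) atTop (nhds 0) := by
    have hd := (hf.sub hf').abs
    have hs2 := ((hf.add hf').abs).const_add (2 * M)
    have hprod := (hd.mul hs2).sqrt
    simp only [sub_self, abs_zero, zero_mul, Real.sqrt_zero] at hprod
    refine squeeze_zero_norm (fun n => ?_) hprod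
    refine Real.le_sqrt_of_sq_le ?_
    have h1 := (hstep n).2.2 _ (hmem n)
    rw [sub_self, norm_zero] at h1
    set a := f (z n).1
    set b := f (z (n + 1)).1
    have h2 : ‖(z n).1 - (z (n + 1)).1‖ ^ 2 ≤ (a - b) * (2 * (z n).2 + (a + b)) := by
      nlinarith [h1]
    refine h2.trans ((le_abs_self _).trans ?_)
    rw [abs_mul]
    gcongr
    refine (abs_add_le _ _).trans ?_
    gcongr
    rw [abs_mul, abs_two]
    linarith [hρM n]
  refine ⟨⟨M, hM⟩, hfst.prodMk_nhds hsnd, fun zbar hcl => ?_⟩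
  obtain ⟨φ, hφ, hlim⟩ := hcl.tendsto_subseq
  exact hB.mem_of_tendsto ((hlim.fst_nhds).prodMk_nhds (hf.comp hφ.tendsto_atTop))
    (Eventually.of_forall fun n => ⟨hmem (φ n), rfl⟩)
end
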